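/- Suppose η has second moment (∫_{[0,∞)} v² d|η|(v) < ∞) and h(iy) ≠ 0 for all y ∈ ℝ. Let (Z_t)_{t∈ℝ} be a jointly measurable real-valued process with E|Z_t| < ∞ for all t and stationary increments. If (X_t)_{t∈ℝ} and (Y_t)_{t∈ℝ} are two jointly measurable, strictly stationary processes with E|X_0| < ∞ and E|Y_0| < ∞ such that, for every s < t, almost surely X_t − X_s = ∫_s^t ∫_{[0,∞)} X_{u−v} dη(v) du + Z_t − Z_s and Y_t − Y_s = ∫_s^t ∫_{[0,∞)} Y_{u−v} dη(v) du + Z_t − Z_s, then for every t ∈ ℝ one has X_t = Y_t almost surely (the solution is unique up to modification). -/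

import Mathlib

open MeasureTheory Complex Set
open scoped ENNReal

/-- `h(z) = -z - ∫_{[0,∞)} e^{zv} dη(v)` for the finite signed measure `η = ηp - ηm`. -/
noncomputable def hFun (ηp ηm : Measure ℝ) (z : ℂ) : ℂ :=
  -z - ((∫ v : ℝ, Complex.exp (z * v) ∂ηp) - ∫ v : ℝ, Complex.exp (z * v) ∂ηm)

/-- `u ↦ ∫_{[0,∞)} x(u-v) dη(v)` for the finite signed measure `η = ηp - ηm`. -/
noncomputable def delayInt (ηp ηm : Measure ℝ) (x : ℝ → ℝ) (u : ℝ) : ℝ :=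
  (∫ v : ℝ, x (u - v) ∂ηp) - ∫ v : ℝ, x (u - v) ∂ηm

/-- A process `Z` indexed by `ℝ` has stationary increments. -/
def HasStationaryIncrements {Ω : Type*} [MeasurableSpace Ω] (P : Measure Ω)
    (Z : ℝ → Ω → ℝ) : Prop :=
  ∀ (n : ℕ) (t : Fin n → ℝ) (u : ℝ),
    Measure.map (fun ω (i : Fin n) => Z (t i + u) ω - Z u ω) P =
      Measure.map (fun ω (i : Fin n) => Z (t i) ω - Z 0 ω) P

/-- A process `X` indexed by `ℝ` is strictly stationary. -/
def IsStrictlyStationary {Ω : Type*} [MeasurableSpace Ω] (P : Measure Ω)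
    (X : ℝ → Ω → ℝ) : Prop :=
  ∀ (n : ℕ) (t : Fin n → ℝ) (u : ℝ),
    Measure.map (fun ω (i : Fin n) => X (t i + u) ω) P =
      Measure.map (fun ω (i : Fin n) => X (t i) ω) P

open scoped FourierTransform

/-- The Fourier transform of a compactly supported `C²` function is integrable. -/
theorem integrable_fourier_of_contDiff_two {G : ℝ → ℂ} (hG : ContDiff ℝ 2 G)
    (hc : HasCompactSupport G) : Integrable (𝓕 G) := by
  have hGi : Integrable G := hG.continuous.integrable_of_hasCompactSupport hc
  have hcont : Continuous (𝓕 G) :=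
    VectorFourier.fourierIntegral_continuous Real.continuous_fourierChar
      (by fun_prop) hGi
  have hint : ∀ n : ℕ, (n : ℕ∞) ≤ (2 : ℕ∞) → Integrable (iteratedFDeriv ℝ n G) := fun n hn =>
    (hG.continuous_iteratedFDeriv (by exact_mod_cast hn)).integrable_of_hasCompactSupport
      (hc.iteratedFDeriv n)
  have hb : ∀ n : ℕ, n ≤ 2 → ∃ C : ℝ, ∀ w : ℝ, |w| ^ n * ‖𝓕 G w‖ ≤ C := by
    intro n hn
    have := Real.pow_mul_norm_iteratedFDeriv_fourier_le (K := 0) (N := 2) (f := G) hG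
      (fun k n hk hn => by
        obtain rfl : k = 0 := by simpa using hk
        simpa using (hint n hn).norm) (k := 0) (n := n) le_rfl (by exact_mod_cast hn)
    simp only [norm_iteratedFDeriv_zero, Real.norm_eq_abs] at this
    exact ⟨_, this⟩
  obtain ⟨C₀, h₀⟩ := hb 0 (by norm_num)
  obtain ⟨C₂, h₂⟩ := hb 2 le_rfl
  refine Integrable.mono' (integrable_inv_one_add_sq.const_mul (C₀ + C₂))
    hcont.aestronglyMeasurable (Filter.Eventually.of_forall fun w => ?_)
  rw [← div_eq_mul_inv, le_div_iff₀ (by positivity)]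
  have a := h₀ w
  have b := h₂ w
  rw [sq_abs] at b
  simp only [pow_zero, one_mul] at a
  nlinarith

theorem hFun_eq_charFun (ηp ηm : Measure ℝ) (y : ℝ) :
    hFun ηp ηm (I * y) = -(I * y) - (charFun ηp y - charFun ηm y) := by
  simp only [hFun, charFun_apply_real]
  congr 4 <;> ext v <;> congr 1 <;> ring

theorem contDiff_hFun (ηp ηm : Measure ℝ) [IsFiniteMeasure ηp] [IsFiniteMeasure ηm]
    (hmom2 : Integrable (fun v : ℝ => v ^ 2) (ηp + ηm)) :
    ContDiff ℝ 2 (fun y : ℝ => hFun ηp ηm (I * y)) := by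
  have key : ∀ μ : Measure ℝ, IsFiniteMeasure μ → Integrable (fun v : ℝ => v ^ 2) μ →
      ContDiff ℝ 2 (charFun μ) := fun μ _ hμ =>
    contDiff_charFun (n := 2) ((memLp_two_iff_integrable_sq aestronglyMeasurable_id).2 hμ)
  simp only [hFun_eq_charFun]
  refine ((contDiff_const.mul Complex.ofRealCLM.contDiff).neg).sub
    ((key ηp ‹_› hmom2.left_of_add_measure).sub (key ηm ‹_› hmom2.right_of_add_measure))

theorem integral_fourier_add {μ : Measure ℝ} [IsFiniteMeasure μ] {G : ℝ → ℂ}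
    (hG : Integrable G) (t : ℝ) :
    ∫ v, 𝓕 G (t + v) ∂μ = 𝓕 (fun y => charFun μ (-2 * Real.pi * y) * G y) t := by
  simp only [Real.fourier_real_eq_integral_exp_smul, smul_eq_mul, charFun_apply_real]
  rw [integral_integral_swap]
  · congr 1 with y
    rw [← integral_mul_const, ← integral_const_mul]
    congr 1 with v
    rw [← mul_assoc, ← Complex.exp_add]
    congr 2
    push_cast
    ring
  · have : Integrable (fun p : ℝ × ℝ => G p.2) (μ.prod volume) := hG.comp_snd μ
    refine this.bdd_mul (c := 1) (by fun_prop) (Filter.Eventually.of_forall fun p => ?_)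
    rw [Complex.norm_exp_ofReal_mul_I]

theorem tendsto_integral_scaled {f : ℝ → ℂ} (hf : Continuous f) {C : ℝ} (hC : ∀ x, ‖f x‖ ≤ C)
    {φ : ℝ → ℂ} (hφ : Integrable φ) (a : ℝ) :
    Filter.Tendsto (fun n : ℕ => ∫ s, f (a + s / (n + 1)) * φ s) Filter.atTop
      (nhds (f a * ∫ s, φ s)) := by
  rw [← integral_const_mul]
  refine tendsto_integral_of_dominated_convergence (fun s => C * ‖φ s‖) (fun n => ?_)
    (hφ.norm.const_mul C) (fun n => Filter.Eventually.of_forall fun s => ?_)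
    (Filter.Eventually.of_forall fun s => ?_)
  · exact (hf.comp (by fun_prop)).aestronglyMeasurable.mul hφ.1
  · rw [norm_mul]
    exact mul_le_mul_of_nonneg_right (hC _) (norm_nonneg _)
  · refine Filter.Tendsto.mul_const _ ((hf.tendsto a).comp ?_)
    have : Filter.Tendsto (fun n : ℕ => a + s * (1 / ((n : ℝ) + 1))) Filter.atTop
        (nhds (a + s * 0)) := (tendsto_one_div_add_atTop_nhds_zero_nat.const_mul s).const_add a
    simpa [div_eq_mul_inv] using this

/-- A bounded continuous function annihilating the Fourier transforms of all compactly supported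
`C²` functions vanishes. -/
theorem eq_zero_of_forall_integral_mul_fourier_eq_zero {f : ℝ → ℂ} (hf : Continuous f) {C : ℝ}
    (hC : ∀ x, ‖f x‖ ≤ C)
    (h : ∀ ψ : ℝ → ℂ, ContDiff ℝ 2 ψ → HasCompactSupport ψ → ∫ t, f t * 𝓕 ψ t = 0) (a : ℝ) :
    f a = 0 := by
  obtain ⟨b⟩ : Nonempty (ContDiffBump (0 : ℝ)) := inferInstance
  set χ : ℝ → ℂ := fun y => (b y : ℂ) with hχ
  have hχd : ContDiff ℝ 2 χ := Complex.ofRealCLM.contDiff.comp b.contDiff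
  have hχc : HasCompactSupport χ := b.hasCompactSupport.comp_left Complex.ofReal_zero
  have hχi : Integrable χ := hχd.continuous.integrable_of_hasCompactSupport hχc
  have hFi := integrable_fourier_of_contDiff_two hχd hχc
  have hone : ∫ s, 𝓕 χ s = 1 := by
    have h1 := congrFun (hχd.continuous.fourierInv_fourier_eq hχi hFi) 0
    rw [Real.fourierInv_eq'] at h1
    have : χ 0 = 1 := by
      simp [hχ, b.one_of_mem_closedBall (Metric.mem_closedBall_self b.rIn_pos.le)]
    simpa [this] using h1
  have hlim := tendsto_integral_scaled hf hC hFi a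
  rw [hone, mul_one] at hlim
  refine tendsto_nhds_unique hlim ?_
  refine tendsto_const_nhds.congr fun n => ?_
  have hn : (0 : ℝ) < n + 1 := by positivity
  set c : ℝ := n + 1 with hc
  set ψ : ℝ → ℂ := fun y => Complex.exp ((2 * Real.pi * a * y : ℝ) * I) * χ (y / c) with hψ
  have hψd : ContDiff ℝ 2 ψ := by
    refine ContDiff.mul ?_ (hχd.comp (contDiff_id.div_const c))
    refine ContDiff.cexp (ContDiff.mul ?_ contDiff_const)
    exact Complex.ofRealCLM.contDiff.comp (contDiff_const.mul contDiff_id)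
  have hψc : HasCompactSupport ψ := by
    have : HasCompactSupport (fun y : ℝ => χ (y / c)) := by
      simpa [div_eq_mul_inv, mul_comm] using! hχc.comp_smul (inv_ne_zero hn.ne')
    exact this.mul_left
  have hF : ∀ s : ℝ, 𝓕 ψ (a + s / c) = c * 𝓕 χ s := by
    intro s
    simp only [Real.fourier_real_eq_integral_exp_smul, smul_eq_mul, hψ]
    have := Measure.integral_comp_div (fun y : ℝ =>
      Complex.exp (((-2 * Real.pi * y * s : ℝ) : ℂ) * I) * χ y) c
    rw [abs_of_pos hn, Complex.real_smul] at this
    rw [← this]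
    congr 1 with y
    rw [← mul_assoc, ← Complex.exp_add]
    congr 2
    push_cast
    have : (c : ℂ) ≠ 0 := by exact_mod_cast hn.ne'
    field_simp
    ring
  have h1 := h ψ hψd hψc
  have h2 := Measure.integral_comp_div (fun s : ℝ => f (a + s) * 𝓕 ψ (a + s)) c
  rw [integral_add_left_eq_self (fun t => f t * 𝓕 ψ t) a, h1, smul_zero] at h2
  simp only [hF] at h2
  have h3 : (c : ℂ) * ∫ s, f (a + s / c) * 𝓕 χ s = 0 := by
    rw [← h2, ← integral_const_mul]
    congr 1 with s
    ring
  exact ((mul_eq_zero.1 h3).resolve_left (by exact_mod_cast hn.ne')).symm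

theorem integrable_shear {μ : Measure ℝ} [IsFiniteMeasure μ] {f g : ℝ → ℂ} (hf : Continuous f)
    {C : ℝ} (hC : ∀ x, ‖f x‖ ≤ C) (hg : Integrable g) :
    Integrable (fun p : ℝ × ℝ => f (p.2 - p.1) * g p.2) (μ.prod volume) ∧
      Integrable (fun p : ℝ × ℝ => f p.2 * g (p.2 + p.1)) (μ.prod volume) := by
  have h1 : Integrable (fun p : ℝ × ℝ => f (p.2 - p.1) * g p.2) (μ.prod volume) :=
    (hg.comp_snd μ).bdd_mul (c := C) (hf.comp (by fun_prop)).aestronglyMeasurable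
      (Filter.Eventually.of_forall fun p => hC _)
  refine ⟨h1, ?_⟩
  have h2 := (measurePreserving_prod_add μ (volume : Measure ℝ)).integrable_comp h1.1
  refine (h2.2 h1).congr (Filter.Eventually.of_forall fun p => ?_)
  simp [add_comm]

theorem integral_mul_integral_add {μ : Measure ℝ} [IsFiniteMeasure μ] {f g : ℝ → ℂ}
    (hf : Continuous f) {C : ℝ} (hC : ∀ x, ‖f x‖ ≤ C) (hg : Integrable g) :
    Integrable (fun t => f t * ∫ v, g (t + v) ∂μ) ∧
      Integrable (fun u => (∫ v, f (u - v) ∂μ) * g u) ∧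
      ∫ t, f t * ∫ v, g (t + v) ∂μ = ∫ u, (∫ v, f (u - v) ∂μ) * g u := by
  obtain ⟨h1, h2⟩ := integrable_shear (μ := μ) hf hC hg
  refine ⟨?_, ?_, ?_⟩
  · simpa only [integral_const_mul] using h2.integral_prod_right
  · simpa only [integral_mul_const] using h1.integral_prod_right
  · simp only [← integral_const_mul, ← integral_mul_const]
    rw [← integral_integral_swap (f := fun v t => f t * g (t + v)) h2,
      ← integral_integral_swap (f := fun v u => f (u - v) * g u) h1]
    congr 1 with v
    rw [← integral_sub_right_eq_self _ v]
    simp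

theorem neg_deriv_fourier_sub_delay {ηp ηm : Measure ℝ} [IsFiniteMeasure ηp] [IsFiniteMeasure ηm]
    {G : ℝ → ℂ} (hG : ContDiff ℝ 2 G) (hc : HasCompactSupport G) (t : ℝ) :
    -𝓕 (fun y : ℝ => (-2 * Real.pi * I * y) • G y) t
        - ((∫ v, 𝓕 G (t + v) ∂ηp) - ∫ v, 𝓕 G (t + v) ∂ηm) =
      𝓕 (fun y : ℝ => hFun ηp ηm (I * (-2 * Real.pi * y : ℝ)) * G y) t := by
  have hcont := hG.continuous
  have hchar : ∀ μ : Measure ℝ, IsFiniteMeasure μ → Continuous (charFun μ) :=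
    fun μ _ => continuous_charFun
  have hp := hchar ηp ‹_›
  have hm := hchar ηm ‹_›
  rw [integral_fourier_add (hcont.integrable_of_hasCompactSupport hc),
    integral_fourier_add (hcont.integrable_of_hasCompactSupport hc)]
  simp only [Real.fourier_real_eq_integral_exp_smul, smul_eq_mul]
  have key : ∀ k : ℝ → ℂ, Continuous k → Integrable fun y : ℝ =>
      Complex.exp ((-2 * Real.pi * y * t : ℝ) * I) * (k y * G y) := fun k hk =>
    Continuous.integrable_of_hasCompactSupport (by fun_prop) (hc.mul_left.mul_left)
  rw [← integral_sub (key _ (by fun_prop)) (key _ (by fun_prop)), ← integral_neg, ← integral_sub]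
  · congr 1 with y
    rw [hFun_eq_charFun]
    push_cast
    ring
  · exact (key _ (by fun_prop)).neg
  · exact (key _ (by fun_prop)).sub (key _ (by fun_prop))

section Deterministic

variable {ηp ηm : Measure ℝ} [IsFiniteMeasure ηp] [IsFiniteMeasure ηm] {f : ℝ → ℝ} {C : ℝ}

theorem abs_delayInt_le (hC : ∀ x, |f x| ≤ C) (u : ℝ) :
    |delayInt ηp ηm f u| ≤ C * ηp.real univ + C * ηm.real univ := by
  refine (abs_sub _ _).trans (add_le_add ?_ ?_) <;>
  exact norm_integral_le_of_norm_le_const (f := fun v => f (u - v))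
    (Filter.Eventually.of_forall fun v => hC _)

theorem continuous_delayInt (hf : Continuous f) (hC : ∀ x, |f x| ≤ C) :
    Continuous (delayInt ηp ηm f) := by
  have key : ∀ μ : Measure ℝ, IsFiniteMeasure μ → Continuous fun u => ∫ v, f (u - v) ∂μ :=
    fun μ _ => continuous_of_dominated (bound := fun _ => C)
      (fun u => (hf.comp (by fun_prop)).aestronglyMeasurable)
      (fun u => Filter.Eventually.of_forall fun v => hC _) (integrable_const C)
      (Filter.Eventually.of_forall fun v => hf.comp (by fun_prop))
  exact (key ηp ‹_›).sub (key ηm ‹_›)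

theorem hasDerivAt_of_delay_equation (hC : ∀ x, |f x| ≤ C)
    (heq : ∀ s t, s < t → f t - f s = ∫ u in Ioc s t, delayInt ηp ηm f u) (x : ℝ) :
    HasDerivAt f (delayInt ηp ηm f x) x := by
  have heq' : ∀ s t, f t - f s = ∫ u in s..t, delayInt ηp ηm f u := by
    intro s t
    rcases lt_trichotomy s t with h | rfl | h
    · rw [intervalIntegral.integral_of_le h.le, heq s t h]
    · simp
    · rw [intervalIntegral.integral_of_ge h.le, ← heq t s h]
      ring
  have hcont : Continuous f := by
    refine LipschitzWith.continuous (K := (C * ηp.real univ + C * ηm.real univ).toNNReal) ?_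
    refine LipschitzWith.of_dist_le_mul fun t s => ?_
    rw [Real.dist_eq, Real.dist_eq, heq' s t]
    refine (intervalIntegral.norm_integral_le_of_norm_le_const
      (f := delayInt ηp ηm f) (C := C * ηp.real univ + C * ηm.real univ)
      fun u _ => abs_delayInt_le hC u).trans ?_
    exact mul_le_mul_of_nonneg_right (Real.le_coe_toNNReal _) (abs_nonneg _)
  have hD := continuous_delayInt (ηp := ηp) (ηm := ηm) hcont hC
  have : f = fun t => f 0 + ∫ u in (0 : ℝ)..t, delayInt ηp ηm f u := by
    ext t
    rw [← heq' 0 t]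
    ring
  have h := (hD.integral_hasStrictDerivAt 0 x).hasDerivAt.const_add (f 0)
  rwa [← this] at h

theorem integral_mul_fourier_eq_zero (hf : Continuous f) (hC : ∀ x, |f x| ≤ C)
    (hmom2 : Integrable (fun v : ℝ => v ^ 2) (ηp + ηm))
    (hroot : ∀ y : ℝ, hFun ηp ηm (I * y) ≠ 0)
    (hderiv : ∀ x, HasDerivAt f (delayInt ηp ηm f x) x)
    {ψ : ℝ → ℂ} (hψ : ContDiff ℝ 2 ψ) (hψc : HasCompactSupport ψ) :
    ∫ t, (f t : ℂ) * 𝓕 ψ t = 0 := by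
  obtain ⟨G, hGdef⟩ : ∃ G : ℝ → ℂ,
      G = fun y => (hFun ηp ηm (I * (-2 * Real.pi * y : ℝ)))⁻¹ * ψ y := ⟨_, rfl⟩
  have hlin : ContDiff ℝ 2 fun y : ℝ => -2 * Real.pi * y := by fun_prop
  have hm : ContDiff ℝ 2 fun y : ℝ => hFun ηp ηm (I * (-2 * Real.pi * y : ℝ)) :=
    (contDiff_hFun ηp ηm hmom2).comp hlin
  have hm' := hm.inv fun y => hroot (-2 * Real.pi * y)
  have hG : ContDiff ℝ 2 G := by
    rw [hGdef]
    exact hm'.mul hψ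
  have hGc : HasCompactSupport G := by
    rw [hGdef]
    exact hψc.mul_left
  have hof : ContDiff ℝ 2 fun y : ℝ => (y : ℂ) := Complex.ofRealCLM.contDiff
  have hG' : ContDiff ℝ 2 fun y : ℝ => (-2 * Real.pi * I * y) • G y :=
    (contDiff_const.mul hof).smul hG
  have hGc' : HasCompactSupport fun y : ℝ => (-2 * Real.pi * I * y) • G y := by
    simp only [smul_eq_mul]
    exact hGc.mul_left
  have hψG : ψ = fun y : ℝ => hFun ηp ηm (I * (-2 * Real.pi * y : ℝ)) * G y := by
    ext y
    simp only [hGdef]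
    rw [mul_inv_cancel_left₀ (hroot _)]
  obtain ⟨F, hF⟩ : ∃ F : ℝ → ℂ, F = fun t => (f t : ℂ) := ⟨_, rfl⟩
  have hFc : Continuous F := hF ▸ Complex.continuous_ofReal.comp hf
  have hFC : ∀ x, ‖F x‖ ≤ C := fun x => by simpa [hF] using hC x
  have hg := integrable_fourier_of_contDiff_two hG hGc
  have hg' := integrable_fourier_of_contDiff_two hG' hGc'
  have hgd : ∀ t, HasDerivAt (𝓕 G) (𝓕 (fun y : ℝ => (-2 * Real.pi * I * y) • G y) t) t := by
    refine Real.hasDerivAt_fourier (hG.continuous.integrable_of_hasCompactSupport hGc) ?_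
    exact Continuous.integrable_of_hasCompactSupport
      (continuous_id.smul hG.continuous) (hGc.smul_left (f := id))
  have hD : ∀ u, ((delayInt ηp ηm f u : ℝ) : ℂ) =
      (∫ v, F (u - v) ∂ηp) - ∫ v, F (u - v) ∂ηm := fun u => by
    simp only [delayInt, hF, integral_complex_ofReal, Complex.ofReal_sub]
  obtain ⟨p1, p2, p3⟩ := integral_mul_integral_add (μ := ηp) hFc hFC hg
  obtain ⟨m1, m2, m3⟩ := integral_mul_integral_add (μ := ηm) hFc hFC hg
  have hFg' := hg'.bdd_mul hFc.aestronglyMeasurable (Filter.Eventually.of_forall hFC)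
  have hDg : Integrable fun t => ((delayInt ηp ηm f t : ℝ) : ℂ) * 𝓕 G t := by
    simp only [hD, sub_mul]
    exact p2.sub m2
  have hparts := integral_mul_deriv_eq_deriv_mul_of_integrable (u := F)
    (fun x _ => hF ▸ (hderiv x).ofReal_comp) (fun x _ => hgd x) hFg' hDg
    (hg.bdd_mul hFc.aestronglyMeasurable (Filter.Eventually.of_forall hFC))
  change ∫ t, (fun t => (f t : ℂ)) t * 𝓕 ψ t = 0
  rw [← hF]
  have hsplit : ∀ t, F t * 𝓕 ψ t =
      -(F t * 𝓕 (fun y : ℝ => (-2 * Real.pi * I * y) • G y) t) -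
        (F t * (∫ v, 𝓕 G (t + v) ∂ηp) - F t * ∫ v, 𝓕 G (t + v) ∂ηm) := fun t => by
    rw [hψG, ← neg_deriv_fourier_sub_delay hG hGc]
    ring
  have hneg : Integrable fun t =>
      -(F t * 𝓕 (fun y : ℝ => (-2 * Real.pi * I * y) • G y) t) := hFg'.neg
  have hsub : Integrable fun t =>
      F t * (∫ v, 𝓕 G (t + v) ∂ηp) - F t * ∫ v, 𝓕 G (t + v) ∂ηm := p1.sub m1
  simp only [hsplit]
  rw [integral_sub hneg hsub, integral_neg, integral_sub p1 m1, hparts, p3, m3,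
    ← integral_sub p2 m2]
  simp only [hD, sub_mul, neg_neg, sub_self]

/-- A bounded solution of the homogeneous delay equation vanishes when the characteristic function
`h` has no zeros on the imaginary axis. -/
theorem eq_zero_of_delay_equation (hC : ∀ x, |f x| ≤ C)
    (hmom2 : Integrable (fun v : ℝ => v ^ 2) (ηp + ηm))
    (hroot : ∀ y : ℝ, hFun ηp ηm (I * y) ≠ 0)
    (heq : ∀ s t, s < t → f t - f s = ∫ u in Ioc s t, delayInt ηp ηm f u) (a : ℝ) :
    f a = 0 := by
  have hderiv := hasDerivAt_of_delay_equation hC heq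
  have hf : Continuous f := continuous_iff_continuousAt.2 fun x => (hderiv x).continuousAt
  have := eq_zero_of_forall_integral_mul_fourier_eq_zero (f := fun t => (f t : ℂ)) (C := C)
    (Complex.continuous_ofReal.comp hf) (fun x => by simpa using hC x)
    (fun ψ hψ hψc => integral_mul_fourier_eq_zero hf hC hmom2 hroot hderiv hψ hψc) a
  exact_mod_cast this

end Deterministic

section JointlyMeasurable

variable {Ω : Type*} [MeasurableSpace Ω] {Q : Measure Ω} {X : ℝ → Ω → ℝ} {K : ℝ≥0∞}

theorem IsStrictlyStationary.identDistrib (hX : Measurable (Function.uncurry X))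
    (h : IsStrictlyStationary Q X) (t : ℝ) :
    ProbabilityTheory.IdentDistrib (X t) (X 0) Q Q := by
  have hXm : ∀ t, Measurable (X t) := fun t => hX.comp measurable_prodMk_left
  refine ⟨(hXm t).aemeasurable, (hXm 0).aemeasurable, ?_⟩
  have h1 := congrArg (Measure.map fun x : Fin 1 → ℝ => x 0) (h 1 (fun _ => 0) t)
  rw [Measure.map_map (measurable_pi_apply 0) (measurable_pi_lambda _ fun i => hXm _),
    Measure.map_map (measurable_pi_apply 0) (measurable_pi_lambda _ fun i => hXm _)] at h1
  simpa [Function.comp_def] using h1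

theorem integrable_process (hX : Measurable (Function.uncurry X)) (hK : K ≠ ∞)
    (hXK : ∀ t, ∫⁻ ω, ‖X t ω‖ₑ ∂Q ≤ K) (t : ℝ) : Integrable (X t) Q :=
  ⟨(hX.comp measurable_prodMk_left).aestronglyMeasurable, (hXK t).trans_lt hK.lt_top⟩

theorem abs_integral_process_le (hK : K ≠ ∞) (hXK : ∀ t, ∫⁻ ω, ‖X t ω‖ₑ ∂Q ≤ K) (t : ℝ) :
    |∫ ω, X t ω ∂Q| ≤ K.toReal := by
  have h := (enorm_integral_le_lintegral_enorm (X t)).trans (hXK t)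
  simpa using ENNReal.toReal_mono hK h

variable [IsFiniteMeasure Q] {ηp ηm : Measure ℝ} [IsFiniteMeasure ηp] [IsFiniteMeasure ηm]

theorem integrable_process_comp (hX : Measurable (Function.uncurry X)) (hK : K ≠ ∞)
    (hXK : ∀ t, ∫⁻ ω, ‖X t ω‖ₑ ∂Q ≤ K) {S : Type*} [MeasurableSpace S] {κ : Measure S}
    [IsFiniteMeasure κ] {τ : S → ℝ} (hτ : Measurable τ) :
    Integrable (fun p : Ω × S => X (τ p.2) p.1) (Q.prod κ) := by
  have hm : Measurable fun p : Ω × S => X (τ p.2) p.1 :=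
    hX.comp (f := fun p : Ω × S => (τ p.2, p.1)) (by fun_prop)
  refine ⟨hm.aestronglyMeasurable, ?_⟩
  rw [HasFiniteIntegral, lintegral_prod_symm _ hm.enorm.aemeasurable]
  calc ∫⁻ s, ∫⁻ ω, ‖X (τ s) ω‖ₑ ∂Q ∂κ ≤ ∫⁻ _, K ∂κ := lintegral_mono fun s => hXK _
    _ = K * κ univ := lintegral_const _
    _ < ∞ := ENNReal.mul_lt_top hK.lt_top (measure_lt_top κ _)

theorem integrable_delayInt_process (hX : Measurable (Function.uncurry X)) (hK : K ≠ ∞)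
    (hXK : ∀ t, ∫⁻ ω, ‖X t ω‖ₑ ∂Q ≤ K) (ν : Measure ℝ) [IsFiniteMeasure ν] :
    Integrable (fun p : Ω × ℝ => delayInt ηp ηm (fun r => X r p.1) p.2) (Q.prod ν) := by
  have key : ∀ μ : Measure ℝ, IsFiniteMeasure μ →
      Integrable (fun p : Ω × ℝ => ∫ v, X (p.2 - v) p.1 ∂μ) (Q.prod ν) := fun μ _ => by
    have h := integrable_process_comp (κ := ν.prod μ) hX hK hXK
      (τ := fun p : ℝ × ℝ => p.1 - p.2) (by fun_prop)
    have h' := ((measurePreserving_prodAssoc Q ν μ).integrable_comp h.1).2 h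
    exact h'.integral_prod_left
  exact (key ηp ‹_›).sub (key ηm ‹_›)

theorem integral_delayInt_process (hX : Measurable (Function.uncurry X)) (hK : K ≠ ∞)
    (hXK : ∀ t, ∫⁻ ω, ‖X t ω‖ₑ ∂Q ≤ K) (u : ℝ) :
    ∫ ω, delayInt ηp ηm (fun r => X r ω) u ∂Q =
      delayInt ηp ηm (fun r => ∫ ω, X r ω ∂Q) u := by
  have key : ∀ μ : Measure ℝ, IsFiniteMeasure μ →
      Integrable (fun p : Ω × ℝ => X (u - p.2) p.1) (Q.prod μ) := fun μ _ =>
    integrable_process_comp hX hK hXK (τ := fun v => u - v) (by fun_prop)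
  have hp := key ηp ‹_›
  have hm := key ηm ‹_›
  simp only [delayInt]
  rw [integral_sub hp.integral_prod_left hm.integral_prod_left,
    integral_integral_swap (f := fun ω v => X (u - v) ω) hp,
    integral_integral_swap (f := fun ω v => X (u - v) ω) hm]

theorem integral_integral_delayInt_process (hX : Measurable (Function.uncurry X)) (hK : K ≠ ∞)
    (hXK : ∀ t, ∫⁻ ω, ‖X t ω‖ₑ ∂Q ≤ K) (s t : ℝ) :
    Integrable (fun ω => ∫ u in Ioc s t, delayInt ηp ηm (fun r => X r ω) u) Q ∧
      Integrable (delayInt ηp ηm fun r => ∫ ω, X r ω ∂Q) (volume.restrict (Ioc s t)) ∧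
      ∫ ω, (∫ u in Ioc s t, delayInt ηp ηm (fun r => X r ω) u) ∂Q =
        ∫ u in Ioc s t, delayInt ηp ηm (fun r => ∫ ω, X r ω ∂Q) u := by
  have h := integrable_delayInt_process (ηp := ηp) (ηm := ηm) hX hK hXK
    (volume.restrict (Ioc s t))
  refine ⟨h.integral_prod_left, ?_, ?_⟩
  · exact h.integral_prod_right.congr
      (Filter.Eventually.of_forall fun u => integral_delayInt_process hX hK hXK u)
  · rw [integral_integral_swap h]
    simp only [integral_delayInt_process hX hK hXK]

theorem stronglyMeasurable_integral_process (hX : Measurable (Function.uncurry X)) :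
    StronglyMeasurable fun t => ∫ ω, X t ω ∂Q :=
  hX.stronglyMeasurable.integral_prod_right

theorem delayInt_sub {f g : ℝ → ℝ} {C D : ℝ} (hf : StronglyMeasurable f) (hC : ∀ x, |f x| ≤ C)
    (hg : StronglyMeasurable g) (hD : ∀ x, |g x| ≤ D) (u : ℝ) :
    delayInt ηp ηm (fun r => f r - g r) u = delayInt ηp ηm f u - delayInt ηp ηm g u := by
  have key : ∀ μ : Measure ℝ, IsFiniteMeasure μ → ∀ (k : ℝ → ℝ) (B : ℝ), StronglyMeasurable k →
      (∀ x, |k x| ≤ B) → Integrable (fun v => k (u - v)) μ := fun μ _ k B hk hB =>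
    (integrable_const B).mono' (hk.comp_measurable (by fun_prop)).aestronglyMeasurable
      (Filter.Eventually.of_forall fun v => hB _)
  simp only [delayInt]
  rw [integral_sub (key ηp ‹_› f C hf hC) (key ηp ‹_› g D hg hD),
    integral_sub (key ηm ‹_› f C hf hC) (key ηm ‹_› g D hg hD)]
  ring

end JointlyMeasurable

/-- Theorem 2.4, uniqueness. Suppose `η` has second moment and
`h(iy) ≠ 0` for all `y`. If `X` and `Y` are jointly measurable, strictly stationary,
integrable solutions of the SDDE driven by the same noise `Z`, then `X_t = Y_t` a.s. for
every `t` (uniqueness up to modification). -/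
theorem statement8
    (ηp ηm : Measure ℝ) [IsFiniteMeasure ηp] [IsFiniteMeasure ηm]
    (hsing : ηp ⟂ₘ ηm) (hconcp : ηp (Set.Iio 0) = 0) (hconcm : ηm (Set.Iio 0) = 0)
    (hmom2 : Integrable (fun v : ℝ => v ^ 2) (ηp + ηm))
    (hroot : ∀ y : ℝ, hFun ηp ηm (I * y) ≠ 0)
    {Ω : Type*} [MeasurableSpace Ω] (P : Measure Ω) [IsProbabilityMeasure P]
    (Z : ℝ → Ω → ℝ) (hZmeas : Measurable (Function.uncurry Z))
    (hZint : ∀ t : ℝ, Integrable (Z t) P)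
    (hZstat : HasStationaryIncrements P Z)
    (X Y : ℝ → Ω → ℝ)
    (hXmeas : Measurable (Function.uncurry X)) (hYmeas : Measurable (Function.uncurry Y))
    (hXstat : IsStrictlyStationary P X) (hYstat : IsStrictlyStationary P Y)
    (hXint : Integrable (X 0) P) (hYint : Integrable (Y 0) P)
    (hXsol : ∀ s t : ℝ, s < t → ∀ᵐ ω ∂P,
      X t ω - X s ω =
        (∫ u in Set.Ioc s t, delayInt ηp ηm (fun r => X r ω) u) + (Z t ω - Z s ω))
    (hYsol : ∀ s t : ℝ, s < t → ∀ᵐ ω ∂P,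
      Y t ω - Y s ω =
        (∫ u in Set.Ioc s t, delayInt ηp ηm (fun r => Y r ω) u) + (Z t ω - Z s ω)) :
    ∀ t : ℝ, ∀ᵐ ω ∂P, X t ω = Y t ω := by
  have hXb : ∀ t, ∫⁻ ω, ‖X t ω‖ₑ ∂P = ∫⁻ ω, ‖X 0 ω‖ₑ ∂P := fun t =>
    ((hXstat.identDistrib hXmeas t).comp measurable_enorm).lintegral_eq
  have hYb : ∀ t, ∫⁻ ω, ‖Y t ω‖ₑ ∂P = ∫⁻ ω, ‖Y 0 ω‖ₑ ∂P := fun t =>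
    ((hYstat.identDistrib hYmeas t).comp measurable_enorm).lintegral_eq
  have hKX : ∫⁻ ω, ‖X 0 ω‖ₑ ∂P ≠ ∞ := hXint.2.ne
  have hKY : ∫⁻ ω, ‖Y 0 ω‖ₑ ∂P ≠ ∞ := hYint.2.ne
  have hXi : ∀ t, Integrable (X t) P := integrable_process hXmeas hKX fun t => (hXb t).le
  have hYi : ∀ t, Integrable (Y t) P := integrable_process hYmeas hKY fun t => (hYb t).le
  intro t
  refine (hXi t).ae_eq_of_forall_setIntegral_eq _ _ (hYi t) fun A hA _ => ?_
  have hXA : ∀ t, ∫⁻ ω in A, ‖X t ω‖ₑ ∂P ≤ ∫⁻ ω, ‖X 0 ω‖ₑ ∂P := fun t =>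
    (setLIntegral_le_lintegral _ _).trans (hXb t).le
  have hYA : ∀ t, ∫⁻ ω in A, ‖Y t ω‖ₑ ∂P ≤ ∫⁻ ω, ‖Y 0 ω‖ₑ ∂P := fun t =>
    (setLIntegral_le_lintegral _ _).trans (hYb t).le
  have hXbd := abs_integral_process_le hKX hXA
  have hYbd := abs_integral_process_le hKY hYA
  have hXAi : ∀ t, Integrable (X t) (P.restrict A) := fun t => (hXi t).restrict
  have hYAi : ∀ t, Integrable (Y t) (P.restrict A) := fun t => (hYi t).restrict
  rw [← sub_eq_zero]
  refine eq_zero_of_delay_equation (f := fun t => ∫ ω in A, X t ω ∂P - ∫ ω in A, Y t ω ∂P)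
    (fun t => (abs_sub _ _).trans (add_le_add (hXbd t) (hYbd t))) hmom2 hroot
    (fun s t hst => ?_) t
  obtain ⟨x1, x2, x3⟩ := integral_integral_delayInt_process (ηp := ηp) (ηm := ηm)
    hXmeas hKX hXA s t
  obtain ⟨y1, y2, y3⟩ := integral_integral_delayInt_process (ηp := ηp) (ηm := ηm)
    hYmeas hKY hYA s t
  have hae : ∀ᵐ ω ∂(P.restrict A), (X t ω - X s ω) - (Y t ω - Y s ω) =
      (∫ u in Ioc s t, delayInt ηp ηm (fun r => X r ω) u) -
        ∫ u in Ioc s t, delayInt ηp ηm (fun r => Y r ω) u := by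
    filter_upwards [ae_restrict_of_ae (hXsol s t hst), ae_restrict_of_ae (hYsol s t hst)]
      with ω h1 h2
    rw [h1, h2]
    ring
  have h := integral_congr_ae hae
  have hXst : Integrable (fun ω => X t ω - X s ω) (P.restrict A) := (hXAi t).sub (hXAi s)
  have hYst : Integrable (fun ω => Y t ω - Y s ω) (P.restrict A) := (hYAi t).sub (hYAi s)
  rw [integral_sub hXst hYst,
    integral_sub (hXAi t) (hXAi s), integral_sub (hYAi t) (hYAi s), integral_sub x1 y1, x3, y3,
    ← integral_sub x2 y2] at h
  have hdel : ∀ u, delayInt ηp ηm (fun r => ∫ ω in A, X r ω ∂P - ∫ ω in A, Y r ω ∂P) u =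
      delayInt ηp ηm (fun r => ∫ ω in A, X r ω ∂P) u -
        delayInt ηp ηm (fun r => ∫ ω in A, Y r ω ∂P) u := fun u =>
    delayInt_sub (stronglyMeasurable_integral_process hXmeas) hXbd
      (stronglyMeasurable_integral_process hYmeas) hYbd u
  simp only [hdel]
  rw [← h]
  ring
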